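/- arXiv:1106.5704 — 2 statements merged into one kernel-verified Lean document; each statement's English description precedes it below -/
import Mathlib

section
/- Let G be a group and G₀, G₁ subgroups of G. The number of connected components of the Levi graph of the coset geometry (G : G₀, G₁) equals the index [G : ⟨G₀, G₁⟩] of the subgroup generated by G₀ and G₁ in G. -/
/-- The Levi graph of the coset geometry `(G : G₀, G₁)`: the simple graph on the
disjoint union `(G ⧸ G₀) ⊕ (G ⧸ G₁)` of the left coset spaces, in which a coset
`xG₀` is adjacent to a coset `yG₁` if and only if they have nonempty intersection
as subsets of `G` (i.e. some `g : G` lies in both), and no two vertices on the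
same side are adjacent. -/
def CosetGeometry.levi (G : Type*) [Group G] (G₀ G₁ : Subgroup G) :
    SimpleGraph ((G ⧸ G₀) ⊕ (G ⧸ G₁)) where
  Adj x y :=
    match x, y with
    | Sum.inl p, Sum.inr l => ∃ g : G, (g : G ⧸ G₀) = p ∧ (g : G ⧸ G₁) = l
    | Sum.inr l, Sum.inl p => ∃ g : G, (g : G ⧸ G₀) = p ∧ (g : G ⧸ G₁) = l
    | _, _ => False
  symm := ⟨by rintro (p | l) (p' | l') h <;> exact h⟩
  loopless := ⟨by rintro (p | l) h <;> exact h⟩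

namespace CosetGeometry

variable {G : Type*} [Group G] (G₀ G₁ : Subgroup G)

/-- The coset of `⟨G₀, G₁⟩` containing a vertex of the Levi graph. -/
def toSup : (G ⧸ G₀) ⊕ (G ⧸ G₁) → G ⧸ (G₀ ⊔ G₁) :=
  Sum.elim (Subgroup.quotientMapOfLE le_sup_left) (Subgroup.quotientMapOfLE le_sup_right)

lemma levi_adj_mk (g : G) :
    (levi G G₀ G₁).Adj (Sum.inl (g : G ⧸ G₀)) (Sum.inr (g : G ⧸ G₁)) :=
  ⟨g, rfl, rfl⟩

lemma toSup_eq_of_adj {x y : (G ⧸ G₀) ⊕ (G ⧸ G₁)} (h : (levi G G₀ G₁).Adj x y) :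
    toSup G₀ G₁ x = toSup G₀ G₁ y := by
  rcases x with p | l <;> rcases y with p' | l'
  · exact h.elim
  · obtain ⟨g, rfl, rfl⟩ := h
    rfl
  · obtain ⟨g, rfl, rfl⟩ := h
    rfl
  · exact h.elim

lemma toSup_eq_of_reachable {x y : (G ⧸ G₀) ⊕ (G ⧸ G₁)} (h : (levi G G₀ G₁).Reachable x y) :
    toSup G₀ G₁ x = toSup G₀ G₁ y := by
  obtain ⟨w⟩ := h
  induction w with
  | nil => rfl
  | cons h _ ih => exact (toSup_eq_of_adj G₀ G₁ h).trans ih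

lemma reachable_mul {h : G} (hh : h ∈ G₀ ⊔ G₁) : ∀ g : G,
    (levi G G₀ G₁).Reachable (Sum.inl (g : G ⧸ G₀)) (Sum.inl ((g * h : G) : G ⧸ G₀)) := by
  rw [Subgroup.sup_eq_closure] at hh
  induction hh using Subgroup.closure_induction with
  | mem x hx =>
    intro g
    rcases hx with hx | hx
    · have e : ((g * x : G) : G ⧸ G₀) = g := QuotientGroup.mk_mul_of_mem g hx
      rw [e]
    · have e : ((g * x : G) : G ⧸ G₁) = g := QuotientGroup.mk_mul_of_mem g hx
      have h1 := (levi_adj_mk G₀ G₁ (g * x)).reachable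
      rw [e] at h1
      exact (levi_adj_mk G₀ G₁ g).reachable.trans h1.symm
  | one => intro g; rw [mul_one]
  | mul x y _ _ hx hy =>
    intro g
    rw [← mul_assoc]
    exact (hx g).trans (hy (g * x))
  | inv x _ hx =>
    intro g
    have h1 := hx (g * x⁻¹)
    rw [inv_mul_cancel_right] at h1
    exact h1.symm

lemma exists_reachable (v : (G ⧸ G₀) ⊕ (G ⧸ G₁)) :
    ∃ g : G, (levi G G₀ G₁).Reachable v (Sum.inl (g : G ⧸ G₀)) := by
  rcases v with p | l
  · obtain ⟨g, rfl⟩ := QuotientGroup.mk_surjective p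
    exact ⟨g, SimpleGraph.Reachable.refl _⟩
  · obtain ⟨g, rfl⟩ := QuotientGroup.mk_surjective l
    exact ⟨g, (levi_adj_mk G₀ G₁ g).reachable.symm⟩

/-- The map from connected components to cosets of `⟨G₀, G₁⟩`. -/
def compMap : (levi G G₀ G₁).ConnectedComponent → G ⧸ (G₀ ⊔ G₁) :=
  Quot.lift (toSup G₀ G₁) fun _ _ h => toSup_eq_of_reachable G₀ G₁ h

lemma compMap_bijective : Function.Bijective (compMap G₀ G₁) := by
  constructor
  · intro c d hcd
    induction c using SimpleGraph.ConnectedComponent.ind with | _ v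
    induction d using SimpleGraph.ConnectedComponent.ind with | _ w
    obtain ⟨a, ha⟩ := exists_reachable G₀ G₁ v
    obtain ⟨b, hb⟩ := exists_reachable G₀ G₁ w
    have e : (a : G ⧸ (G₀ ⊔ G₁)) = b :=
      ((toSup_eq_of_reachable G₀ G₁ ha).symm.trans hcd).trans (toSup_eq_of_reachable G₀ G₁ hb)
    have h1 := reachable_mul G₀ G₁ (QuotientGroup.eq.1 e) a
    rw [mul_inv_cancel_left] at h1
    exact SimpleGraph.ConnectedComponent.sound ((ha.trans h1).trans hb.symm)
  · intro q
    obtain ⟨g, rfl⟩ := QuotientGroup.mk_surjective q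
    exact ⟨(levi G G₀ G₁).connectedComponentMk (Sum.inl (g : G ⧸ G₀)), rfl⟩

end CosetGeometry

/-- The number of connected components of the Levi graph of the coset geometry
`(G : G₀, G₁)` equals the index `[G : ⟨G₀, G₁⟩]` of the subgroup generated by
`G₀` and `G₁` in `G`. -/
theorem levi_card_connectedComponent_eq_index {G : Type*} [Group G] (G₀ G₁ : Subgroup G) :
    Nat.card (CosetGeometry.levi G G₀ G₁).ConnectedComponent = (G₀ ⊔ G₁).index := by
  exact Nat.card_eq_of_bijective _ (CosetGeometry.compMap_bijective G₀ G₁)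
end

section
/- Let X be a connected simple graph with a 2-coloring c : V → Bool such that adjacent vertices receive different colors, and let G be a subgroup of the color-preserving automorphism group Aut_o(X) acting transitively on the edge set of X. Let b be a black vertex and w a white vertex adjacent to b. Then X is isomorphic, by a color-preserving graph isomorphism, to the Levi graph of the coset geometry (G : Stab_G(b), Stab_G(w)), where black vertices correspond to left cosets of Stab_G(b) and white vertices to left cosets of Stab_G(w). -/
/-- Let `X` be a connected simple graph with a proper 2-coloring `c : V → Bool`, and
let `G` be a subgroup of the color-preserving automorphism group of `X` acting
transitively on the edge set of `X`.  If `b` is a black vertex and `w` a white vertex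
adjacent to `b`, then `X` is isomorphic, by a color-preserving graph isomorphism, to
the Levi graph of the coset geometry `(G : Stab_G(b), Stab_G(w))`, black vertices
corresponding to left cosets of `Stab_G(b)` and white ones to left cosets of
`Stab_G(w)`. -/
theorem iso_to_levi_of_stabilizers {V : Type*} (X : SimpleGraph V)
    (hconn : X.Connected)
    (c : V → Bool) (hc : ∀ a b : V, X.Adj a b → c a ≠ c b)
    (G : Subgroup (Equiv.Perm V))
    (hAut : ∀ φ ∈ G, ∀ a b : V, X.Adj (φ a) (φ b) ↔ X.Adj a b)
    (hcol : ∀ φ ∈ G, ∀ v : V, c (φ v) = c v)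
    (hedge : ∀ e ∈ X.edgeSet, ∀ e' ∈ X.edgeSet, ∃ φ ∈ G, Sym2.map (⇑φ) e = e')
    (b w : V) (hb : c b = false) (hw : c w = true) (hbw : X.Adj b w) :
    ∃ e : X ≃g CosetGeometry.levi (↥G) (MulAction.stabilizer (↥G) b)
        (MulAction.stabilizer (↥G) w),
      ∀ v : V, (c v = false ↔ ∃ p, e v = Sum.inl p) := by
  have key : ∀ u v : V, X.Adj u v → c u = false → ∃ g : G, g • b = u ∧ g • w = v := by
    intro u v huv hu
    obtain ⟨φ, hφ, h⟩ := hedge s(b, w) hbw s(u, v) huv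
    rw [Sym2.map_mk, Sym2.eq_iff] at h
    rcases h with ⟨h1, h2⟩ | ⟨h1, h2⟩
    · exact ⟨⟨φ, hφ⟩, h1, h2⟩
    · exfalso
      have h3 := hcol φ hφ w
      have h4 : φ w = u := h2
      rw [h4, hu, hw] at h3
      exact Bool.noConfusion h3
  have hcol' : ∀ (g : G) (v : V), c (g • v) = c v := fun g v => hcol g g.2 v
  have hadj' : ∀ (g : G), X.Adj (g • b) (g • w) := fun g => (hAut g g.2 b w).2 hbw
  haveI : Nontrivial V := ⟨b, w, hbw.ne⟩
  let f : (G ⧸ MulAction.stabilizer G b) ⊕ (G ⧸ MulAction.stabilizer G w) → V :=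
    Sum.elim (MulAction.ofQuotientStabilizer G b) (MulAction.ofQuotientStabilizer G w)
  have fl : ∀ g : G, f (Sum.inl (g : G ⧸ MulAction.stabilizer G b)) = g • b := fun g => rfl
  have fr : ∀ g : G, f (Sum.inr (g : G ⧸ MulAction.stabilizer G w)) = g • w := fun g => rfl
  have cl : ∀ p, c (f (Sum.inl p)) = false := by
    intro p
    induction p using QuotientGroup.induction_on with
    | H g => rw [fl, hcol', hb]
  have cr : ∀ p, c (f (Sum.inr p)) = true := by
    intro p
    induction p using QuotientGroup.induction_on with
    | H g => rw [fr, hcol', hw]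
  have finj : Function.Injective f := by
    rintro (p | p) (q | q) h
    · exact congrArg _ (MulAction.injective_ofQuotientStabilizer G b h)
    · have := cl p
      rw [h, cr q] at this
      exact Bool.noConfusion this
    · have := cr p
      rw [h, cl q] at this
      exact Bool.noConfusion this
    · exact congrArg _ (MulAction.injective_ofQuotientStabilizer G w h)
  have fsurj : Function.Surjective f := by
    intro v
    obtain ⟨u, hu⟩ := hconn.preconnected.exists_adj_of_nontrivial v
    cases hv : c v with
    | false =>
      obtain ⟨g, h1, -⟩ := key v u hu hv
      exact ⟨Sum.inl g, h1⟩
    | true =>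
      have h0 : c u = false := by
        have := hc v u hu
        rw [hv] at this
        cases h : c u
        · rfl
        · exact absurd h.symm this
      obtain ⟨g, -, h2⟩ := key u v hu.symm h0
      exact ⟨Sum.inr g, h2⟩
  have lr : ∀ p l, X.Adj (f (Sum.inl p)) (f (Sum.inr l)) ↔
      ∃ g : G, (g : G ⧸ MulAction.stabilizer G b) = p ∧
        (g : G ⧸ MulAction.stabilizer G w) = l := by
    intro p l
    constructor
    · intro h
      obtain ⟨g, h1, h2⟩ := key _ _ h (cl p)
      exact ⟨g, Sum.inl_injective (finj h1), Sum.inr_injective (finj h2)⟩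
    · rintro ⟨g, rfl, rfl⟩
      exact hadj' g
  let E : CosetGeometry.levi G (MulAction.stabilizer G b) (MulAction.stabilizer G w) ≃g X :=
    { toEquiv := Equiv.ofBijective f ⟨finj, fsurj⟩
      map_rel_iff' := by
        rintro (p | p) (q | q)
        · exact ⟨fun h => hc _ _ h ((cl p).trans (cl q).symm), fun h => h.elim⟩
        · exact lr p q
        · exact (X.adj_comm _ _).trans (lr q p)
        · exact ⟨fun h => hc _ _ h ((cr p).trans (cr q).symm), fun h => h.elim⟩ }
  refine ⟨E.symm, fun v => ?_⟩
  obtain ⟨x, rfl⟩ := fsurj v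
  have hx : E.symm (f x) = x := E.symm_apply_apply x
  rw [hx]
  rcases x with p | p
  · exact ⟨fun _ => ⟨p, rfl⟩, fun _ => cl p⟩
  · constructor
    · intro h
      rw [cr p] at h
      exact Bool.noConfusion h
    · rintro ⟨q, h⟩
      cases h
end
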